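/- Fix k ∈ ℤ. If ker d' ∩ ker d'' ∩ Im d ∩ A^k = Im d'd'' ∩ A^k (i.e., the natural map ⊕_{p+q=k} H_{BC}^{p,q} → H^k is injective), then ker d ∩ A^{k-1} = ((ker d' ∩ ker d'') + Im d) ∩ A^{k-1} (i.e., the natural map ⊕_{p+q=k-1} H_{BC}^{p,q} → H^{k-1} is surjective). -/

import Mathlib

open Submodule

/-- A double complex of complex vector spaces, realized as an internally bigraded
module `W = ⊕_{p,q} A p q` together with global differentials `d'`, `d''` of
bidegrees `(1,0)` and `(0,1)` satisfying `d'∘d' = 0`, `d''∘d'' = 0` and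
`d'∘d'' + d''∘d' = 0`. -/
structure BiComplex (W : Type*) [AddCommGroup W] [Module ℂ W] where
  A : ℤ → ℤ → Submodule ℂ W
  d' : W →ₗ[ℂ] W
  d'' : W →ₗ[ℂ] W
  internal : DirectSum.IsInternal (fun pq : ℤ × ℤ => A pq.1 pq.2)
  map_d' : ∀ p q : ℤ, (A p q).map d' ≤ A (p + 1) q
  map_d'' : ∀ p q : ℤ, (A p q).map d'' ≤ A p (q + 1)
  d'_sq : d' ∘ₗ d' = 0
  d''_sq : d'' ∘ₗ d'' = 0
  anticomm : d' ∘ₗ d'' + d'' ∘ₗ d' = 0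

namespace BiComplex

variable {W : Type*} [AddCommGroup W] [Module ℂ W] (C : BiComplex W)

/-- `ker d' ∩ A^{p,q}` : the kernel of `d' : A^{p,q} → A^{p+1,q}`. -/
def kerd' (p q : ℤ) : Submodule ℂ W := LinearMap.ker C.d' ⊓ C.A p q

/-- `ker d'' ∩ A^{p,q}` : the kernel of `d'' : A^{p,q} → A^{p,q+1}`. -/
def kerd'' (p q : ℤ) : Submodule ℂ W := LinearMap.ker C.d'' ⊓ C.A p q

/-- `Im d' ∩ A^{p,q} = d'(A^{p-1,q})`. -/
def imd' (p q : ℤ) : Submodule ℂ W := (C.A (p - 1) q).map C.d'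

/-- `Im d'' ∩ A^{p,q} = d''(A^{p,q-1})`. -/
def imd'' (p q : ℤ) : Submodule ℂ W := (C.A p (q - 1)).map C.d''

/-- `Im d'd'' ∩ A^{p,q} = (d'∘d'')(A^{p-1,q-1})`. -/
def imd'd'' (p q : ℤ) : Submodule ℂ W := (C.A (p - 1) (q - 1)).map (C.d' ∘ₗ C.d'')

/-- `ker d'd'' ∩ A^{p,q}` : the kernel of `d'∘d'' : A^{p,q} → A^{p+1,q+1}`. -/
def kerd'd'' (p q : ℤ) : Submodule ℂ W := LinearMap.ker (C.d' ∘ₗ C.d'') ⊓ C.A p q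

/-- The `d'd''`-lemma at `(p,q)`:
`Im d' ∩ ker d'' ∩ A^{p,q} = ker d' ∩ Im d'' ∩ A^{p,q} = Im d'd'' ∩ A^{p,q}`. -/
def DDLemmaAt (p q : ℤ) : Prop :=
  C.imd' p q ⊓ C.kerd'' p q = C.imd'd'' p q ∧ C.kerd' p q ⊓ C.imd'' p q = C.imd'd'' p q

/-- The total-degree piece `A^k = ⊕_{p+q=k} A^{p,q}`. -/
def Atot (k : ℤ) : Submodule ℂ W := ⨆ p : ℤ, C.A p (k - p)

/-- The total differential `d = d' + d''`. -/
def dtot : W →ₗ[ℂ] W := C.d' + C.d''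

/-- `ker d ∩ A^k` : the kernel of `d : A^k → A^{k+1}`. -/
def kerdTot (k : ℤ) : Submodule ℂ W := LinearMap.ker C.dtot ⊓ C.Atot k

/-- `Im d ∩ A^k = d(A^{k-1})`. -/
def imdTot (k : ℤ) : Submodule ℂ W := (C.Atot (k - 1)).map C.dtot

/-- `ker d' ∩ ker d'' ∩ A^k = ⊕_{p+q=k} (ker d' ∩ ker d'' ∩ A^{p,q})`. -/
def kerd'kerd''Tot (k : ℤ) : Submodule ℂ W :=
  ⨆ p : ℤ, (C.kerd' p (k - p) ⊓ C.kerd'' p (k - p))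

/-- `Im d'd'' ∩ A^k = ⊕_{p+q=k} (Im d'd'' ∩ A^{p,q})`. -/
def imd'd''Tot (k : ℤ) : Submodule ℂ W := ⨆ p : ℤ, C.imd'd'' p (k - p)

/-- `ker d'd'' ∩ A^k = ⊕_{p+q=k} (ker d'd'' ∩ A^{p,q})`. -/
def kerd'd''Tot (k : ℤ) : Submodule ℂ W := ⨆ p : ℤ, C.kerd'd'' p (k - p)

/-- `Im d' ∩ A^k = ⊕_{p+q=k} (Im d' ∩ A^{p,q})`. -/
def imd'Tot (k : ℤ) : Submodule ℂ W := ⨆ p : ℤ, C.imd' p (k - p)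

/-- `Im d'' ∩ A^k = ⊕_{p+q=k} (Im d'' ∩ A^{p,q})`. -/
def imd''Tot (k : ℤ) : Submodule ℂ W := ⨆ p : ℤ, C.imd'' p (k - p)

/-- The double complex is totally bounded: `A^{p,q} = 0` for `|p| > N` or `|q| > N`. -/
def TotallyBounded : Prop :=
  ∃ N : ℕ, ∀ p q : ℤ, ((N : ℤ) < |p| ∨ (N : ℤ) < |q|) → C.A p q = ⊥

end BiComplex

/-- The quotient vector space `S / T` of a submodule `S` by (the trace of) a
submodule `T ≤ S`. -/
abbrev quotSub {W : Type*} [AddCommGroup W] [Module ℂ W] (S T : Submodule ℂ W) :=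
  S ⧸ (Submodule.comap S.subtype T)

namespace BiComplex

/-- The projections of the bigrading, as a family of linear endomorphisms. -/
theorem exists_proj {W : Type*} [AddCommGroup W] [Module ℂ W] (C : BiComplex W) :
    ∃ π : ℤ → ℤ → W →ₗ[ℂ] W, (∀ p q, ∀ x ∈ C.A p q, π p q x = x) ∧
      ∀ p q p' q', p' ≠ p → ∀ x ∈ C.A p' q', π p q x = 0 := by
  classical
  let := C.internal.chooseDecomposition
  refine ⟨fun p q => (C.A p q).subtype ∘ₗ
    DirectSum.component ℂ (ℤ × ℤ) (fun i => C.A i.1 i.2) (p, q) ∘ₗ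
    (DirectSum.decomposeLinearEquiv (fun i : ℤ × ℤ => C.A i.1 i.2)).toLinearMap, ?_, ?_⟩
  · intro p q x hx
    exact DirectSum.decompose_of_mem_same (fun i : ℤ × ℤ => C.A i.1 i.2) (i := (p, q)) hx
  · intro p q p' q' hne x hx
    exact DirectSum.decompose_of_mem_ne (fun i : ℤ × ℤ => C.A i.1 i.2)
      (i := (p', q')) (j := (p, q)) hx (fun h => hne (congrArg Prod.fst h))

variable {W : Type*} [AddCommGroup W] [Module ℂ W] (C : BiComplex W)

/-- A finite sum of homogeneous elements of a given total degree vanishes only if every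
summand does. -/
theorem eq_zero_of_sum_eq_zero {k : ℤ} {g : ℤ → W} (hg : ∀ p, g p ∈ C.A p (k - p))
    {s : Finset ℤ} (hs : ∀ p ∉ s, g p = 0) (h : ∑ p ∈ s, g p = 0) (p : ℤ) : g p = 0 := by
  obtain ⟨π, hπ, hπ'⟩ := C.exists_proj
  have h1 := congrArg (π p (k - p)) h
  rw [map_sum, map_zero, Finset.sum_eq_single p
    (fun j _ hj => hπ' _ _ _ _ hj _ (hg j)) (fun hp => by rw [hs p hp, map_zero])] at h1
  rw [← hπ p (k - p) (g p) (hg p), h1]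

/-- A homogeneous element of a direct sum of submodules of the bigraded pieces lies in the
summand of its own bidegree. -/
theorem mem_of_mem_iSup {k : ℤ} {S : ℤ → Submodule ℂ W} (hS : ∀ p, S p ≤ C.A p (k - p))
    {p : ℤ} {y : W} (hy : y ∈ C.A p (k - p)) (h : y ∈ ⨆ j, S j) : y ∈ S p := by
  obtain ⟨π, hπ, hπ'⟩ := C.exists_proj
  obtain ⟨g, hg, rfl⟩ := (Submodule.mem_iSup_iff_exists_finsupp _ _).1 h
  have h1 := hπ _ _ _ hy
  rw [Finsupp.sum, map_sum, Finset.sum_eq_single p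
    (fun j _ hj => hπ' _ _ _ _ hj _ (hS j (hg j)))
    (fun hp => by rw [Finsupp.notMem_support_iff.1 hp, map_zero]),
    hπ _ _ _ (hS p (hg p))] at h1
  rw [Finsupp.sum, ← h1]
  exact hg p

theorem d'_mem {p q p' : ℤ} (hp : p + 1 = p') {x : W} (hx : x ∈ C.A p q) :
    C.d' x ∈ C.A p' q :=
  hp ▸ C.map_d' p q ⟨x, hx, rfl⟩

theorem d''_mem {p q q' : ℤ} (hq : q + 1 = q') {x : W} (hx : x ∈ C.A p q) :
    C.d'' x ∈ C.A p q' :=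
  hq ▸ C.map_d'' p q ⟨x, hx, rfl⟩

theorem d'_d' (x : W) : C.d' (C.d' x) = 0 := LinearMap.congr_fun C.d'_sq x

theorem d''_d'' (x : W) : C.d'' (C.d'' x) = 0 := LinearMap.congr_fun C.d''_sq x

theorem d''_d' (x : W) : C.d'' (C.d' x) = -C.d' (C.d'' x) :=
  eq_neg_of_add_eq_zero_right (LinearMap.congr_fun C.anticomm x)

theorem dtot_apply (x : W) : C.dtot x = C.d' x + C.d'' x := rfl

theorem dtot_dtot (x : W) : C.dtot (C.dtot x) = 0 := by
  simp [dtot_apply, d'_d', d''_d'', d''_d']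

theorem mem_Atot {p q k : ℤ} (hk : p + q = k) {x : W} (hx : x ∈ C.A p q) : x ∈ C.Atot k := by
  obtain rfl : q = k - p := by lia
  exact Submodule.mem_iSup_of_mem p hx

theorem imdTot_le_kerdTot (k : ℤ) : C.imdTot k ≤ C.kerdTot k := by
  refine le_inf ?_ ?_
  · rintro _ ⟨x, -, rfl⟩
    exact C.dtot_dtot x
  · rw [imdTot, Submodule.map_le_iff_le_comap, Atot]
    exact iSup_le fun p x hx => add_mem
      (C.mem_Atot (by lia) (C.d'_mem rfl hx)) (C.mem_Atot (by lia) (C.d''_mem rfl hx))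

theorem kerd'kerd''Tot_le_kerdTot (k : ℤ) : C.kerd'kerd''Tot k ≤ C.kerdTot k := by
  refine iSup_le fun p x hx => ⟨?_, C.mem_Atot (by lia) hx.1.2⟩
  have h1 : C.d' x = 0 := hx.1.1
  have h2 : C.d'' x = 0 := hx.2.1
  simp [dtot_apply, h1, h2]

/-- The sum of a finitely supported family of `d'`-images, reindexed by target degree,
together with the sum of the `d''`-images, is a total differential. -/
theorem sum_shift {f : ℤ → W} {s : Finset ℤ} (hs : ∀ p ∉ s, f p = 0) :
    ∑ p ∈ s ∪ s.map (Equiv.addRight (1 : ℤ)).toEmbedding, (C.d' (f (p - 1)) + C.d'' (f p)) =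
      C.dtot (∑ p ∈ s, f p) := by
  have h1 : ∑ p ∈ s, C.d' (f p) =
      ∑ p ∈ s ∪ s.map (Equiv.addRight (1 : ℤ)).toEmbedding, C.d' (f (p - 1)) := by
    rw [← Finset.sum_subset Finset.subset_union_right, Finset.sum_map]
    · simp
    · intro p _ hp
      rw [hs (p - 1), map_zero]
      exact fun h => hp (Finset.mem_map.2 ⟨p - 1, h, by simp⟩)
  have h2 : ∑ p ∈ s, C.d'' (f p) =
      ∑ p ∈ s ∪ s.map (Equiv.addRight (1 : ℤ)).toEmbedding, C.d'' (f p) :=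
    Finset.sum_subset Finset.subset_union_left fun p _ hp => by rw [hs p hp, map_zero]
  rw [dtot_apply, map_sum, map_sum, h1, h2, Finset.sum_add_distrib]

/-- The components of a `d`-closed element satisfy `d' x_{p-1} + d'' x_p = 0`. -/
theorem d'_add_d''_eq_zero {k : ℤ} {f : ℤ → W} (hf : ∀ p, f p ∈ C.A p (k - p))
    {s : Finset ℤ} (hs : ∀ p ∉ s, f p = 0) (h : C.dtot (∑ p ∈ s, f p) = 0) (p : ℤ) :
    C.d' (f (p - 1)) + C.d'' (f p) = 0 := by
  refine C.eq_zero_of_sum_eq_zero (k := k + 1)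
    (g := fun p => C.d' (f (p - 1)) + C.d'' (f p)) (fun p => ?_) (fun p hp => ?_)
    ((C.sum_shift hs).trans h) p
  · refine add_mem (C.d'_mem (sub_add_cancel p 1) ?_) (C.d''_mem (by lia) (hf p))
    have := hf (p - 1)
    rwa [show k - (p - 1) = k + 1 - p by lia] at this
  · rw [Finset.notMem_union] at hp
    have h1 : f (p - 1) = 0 :=
      hs _ fun h => hp.2 (Finset.mem_map.2 ⟨p - 1, h, by simp⟩)
    simp [h1, hs p hp.1]

/-- If `d' x_{p-1} + d'' x_p = 0` for all `p`, the total differential of a partial sum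
telescopes to its boundary terms. -/
theorem dtot_sum_range {f : ℤ → W} (h : ∀ p, C.d' (f (p - 1)) + C.d'' (f p) = 0)
    (p : ℤ) (n : ℕ) :
    C.dtot (∑ i ∈ Finset.range n, f (p + 1 + i)) = C.d' (f (p + n)) - C.d' (f p) := by
  induction n with
  | zero => simp
  | succ n ih =>
    have h1 := h (p + 1 + n)
    rw [show p + 1 + (n : ℤ) - 1 = p + n by lia] at h1
    rw [Finset.sum_range_succ, map_add, ih, dtot_apply, eq_neg_of_add_eq_zero_right h1,
      show p + ((n + 1 : ℕ) : ℤ) = p + 1 + n by push_cast; ring]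
    abel

/-- Each `d' x_p` arising from a `d`-closed element is `d`-exact. -/
theorem d'_mem_imdTot {k : ℤ} {f : ℤ → W} (hf : ∀ p, f p ∈ C.A p (k - 1 - p))
    {s : Finset ℤ} (hs : ∀ p ∉ s, f p = 0)
    (h : ∀ p, C.d' (f (p - 1)) + C.d'' (f p) = 0) (p : ℤ) : C.d' (f p) ∈ C.imdTot k := by
  obtain ⟨n, hn⟩ := Infinite.exists_notMem_finset (s.image fun j => (j - p).toNat)
  have hn' : f (p + n) = 0 := hs _ fun hmem => hn (Finset.mem_image.2 ⟨_, hmem, by simp⟩)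
  refine ⟨-∑ i ∈ Finset.range n, f (p + 1 + i),
    neg_mem (sum_mem fun i _ => C.mem_Atot (by lia) (hf _)), ?_⟩
  rw [map_neg, C.dtot_sum_range h, hn', map_zero, zero_sub, neg_neg]

end BiComplex

/-- Fix `k`.  If
`ker d' ∩ ker d'' ∩ Im d ∩ A^k = Im d'd'' ∩ A^k` (i.e. the natural map
`⊕_{p+q=k} H_BC^{p,q} → H^k` is injective), then
`ker d ∩ A^{k-1} = ((ker d' ∩ ker d'') + Im d) ∩ A^{k-1}` (i.e. the natural map
`⊕_{p+q=k-1} H_BC^{p,q} → H^{k-1}` is surjective). -/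
theorem bicomplex_phi_inj_implies_phi_surj
    {W : Type*} [AddCommGroup W] [Module ℂ W] (C : BiComplex W) (k : ℤ)
    (h : C.kerd'kerd''Tot k ⊓ C.imdTot k = C.imd'd''Tot k) :
    C.kerdTot (k - 1) = C.kerd'kerd''Tot (k - 1) ⊔ C.imdTot (k - 1) := by
  refine le_antisymm ?_
    (sup_le (C.kerd'kerd''Tot_le_kerdTot _) (C.imdTot_le_kerdTot _))
  rintro x ⟨hx, hxA⟩
  obtain ⟨f, hf, rfl⟩ := (Submodule.mem_iSup_iff_exists_finsupp _ _).1 hxA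
  have hs : ∀ p ∉ f.support, f p = 0 := fun p => Finsupp.notMem_support_iff.1
  have hrel := C.d'_add_d''_eq_zero hf hs hx
  have hz : ∀ p, ∃ z ∈ C.A p (k - 2 - p), C.d' (C.d'' z) = C.d' (f p) ∧ (f p = 0 → z = 0) := by
    intro p
    by_cases hp : f p = 0
    · exact ⟨0, zero_mem _, by simp [hp], fun _ => rfl⟩
    have hmem : C.d' (f p) ∈ C.A (p + 1) (k - (p + 1)) := by
      have := C.d'_mem rfl (hf p)
      rwa [show k - 1 - p = k - (p + 1) by lia] at this
    have hclosed : C.d'' (C.d' (f p)) = 0 := by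
      rw [C.d''_d', ← eq_neg_of_add_eq_zero_left (a := C.d' (C.d' (f (p - 1)))), C.d'_d']
      rw [← map_add, hrel, map_zero]
    have hBC : C.d' (f p) ∈ C.kerd'kerd''Tot k :=
      Submodule.mem_iSup_of_mem (p + 1) ⟨⟨C.d'_d' _, hmem⟩, ⟨hclosed, hmem⟩⟩
    have him : C.d' (f p) ∈ C.imd'd''Tot k :=
      h ▸ ⟨hBC, C.d'_mem_imdTot hf hs hrel p⟩
    obtain ⟨z, hzA, hz⟩ : C.d' (f p) ∈ C.imd'd'' (p + 1) (k - (p + 1)) := by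
      refine C.mem_of_mem_iSup (S := fun j => C.imd'd'' j (k - j)) (fun j => ?_) hmem him
      rintro _ ⟨z, hzA, rfl⟩
      exact C.d'_mem (by lia) (C.d''_mem (by lia) hzA)
    rw [show p + 1 - 1 = p by lia, show k - (p + 1) - 1 = k - 2 - p by lia] at hzA
    exact ⟨z, hzA, hz, fun h => absurd h hp⟩
  choose z hzA hz hz0 using hz
  have hzs : ∀ p ∉ f.support, z p = 0 := fun p hp => hz0 p (hs p hp)
  rw [Finsupp.sum, ← sub_add_cancel (∑ p ∈ f.support, f p) (C.dtot (∑ p ∈ f.support, z p))]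
  refine Submodule.add_mem_sup ?_
    ⟨_, sum_mem fun p _ => C.mem_Atot (by lia) (hzA p), rfl⟩
  rw [← C.sum_shift hzs, Finset.sum_subset Finset.subset_union_left fun p _ hp => hs p hp,
    ← Finset.sum_sub_distrib]
  refine sum_mem fun p _ => Submodule.mem_iSup_of_mem p ?_
  have hA : f p - (C.d' (z (p - 1)) + C.d'' (z p)) ∈ C.A p (k - 1 - p) := by
    refine sub_mem (hf p) (add_mem (C.d'_mem (sub_add_cancel p 1) ?_) (C.d''_mem (by lia) (hzA p)))
    have := hzA (p - 1)
    rwa [show k - 2 - (p - 1) = k - 1 - p by lia] at this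
  refine ⟨⟨?_, hA⟩, ⟨?_, hA⟩⟩
  · simp [C.d'_d', hz]
  · simp [C.d''_d'', C.d''_d', hz, eq_neg_of_add_eq_zero_right (hrel p)]
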